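/- Let α be a rewb over Σ all of whose number characters are ≤ κ, let Δ_κ = Σ ⊎ {[_i, ]_i, i : 1 ≤ i ≤ κ}, and let A = (Q, Δ_κ, δ, q₀, F) be an NFA with L(A) = Ref(α) satisfying: (a) every state of A is reachable from q₀ and can reach some final state, and (b) whenever q' ∈ δ(q, [_i) or q' ∈ δ(q, ]_i), there is no other transition from q to q' (i.e., q' ∉ δ(q, c) for every character c other than that bracket). Then for every state q and all strings v₁, v₂ over Δ_κ with q ∈ δ̂(q₀, v₁) and q ∈ δ̂(q₀, v₂), open(v₁) = open(v₂). -/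

import Mathlib

namespace Rewbs

/-- Extended alphabet Δ = Σ ⊎ B ⊎ ℕ⁺ : ordinary characters, brackets `[_i`, `]_i`,
and number characters (references). -/
inductive RSym (A : Type) : Type where
  | ch : A → RSym A
  | open_ : ℕ+ → RSym A
  | close : ℕ+ → RSym A
  | ref : ℕ+ → RSym A

/-- The alphabet Σ ⊎ B (no number characters). -/
inductive BSym (A : Type) : Type where
  | ch : A → BSym A
  | open_ : ℕ+ → BSym A
  | close : ℕ+ → BSym A

/-- The homomorphism g : (Σ ⊎ B)* → Σ* erasing brackets. -/
def projB {A : Type} (v : List (BSym A)) : List A :=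
  v.filterMap fun c => match c with
    | .ch a => some a
    | _ => none

/-- The fetching function fet_i. -/
noncomputable def fet {A : Type} (i : ℕ+) (v : List (BSym A)) : List A :=
  letI : DecidableEq (BSym A) := Classical.decEq _
  if BSym.open_ i ∈ v then
    projB (((v.reverse.takeWhile (fun c => decide (c ≠ BSym.open_ i))).reverse).takeWhile
      (fun c => decide (c ≠ BSym.close i)))
  else []

/-- One step of the pre-dereferencing function (processing one character, appended
at the right of the already-processed string). -/
noncomputable def derefStep {A : Type} (acc : List (BSym A)) : RSym A → List (BSym A)
  | .ch a => acc ++ [BSym.ch a]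
  | .open_ i => acc ++ [BSym.open_ i]
  | .close i => acc ++ [BSym.close i]
  | .ref i => acc ++ (fet i acc).map BSym.ch

/-- The pre-dereferencing function D : Δ* → (Σ ⊎ B)*. -/
noncomputable def preDeref {A : Type} (v : List (RSym A)) : List (BSym A) :=
  v.foldl derefStep []

/-- μ_i = fet_i ∘ D. -/
noncomputable def mu {A : Type} (i : ℕ+) (v : List (RSym A)) : List A :=
  fet i (preDeref v)

/-- deref = g ∘ D. -/
noncomputable def deref {A : Type} (v : List (RSym A)) : List A :=
  projB (preDeref v)

/-- One step of the `open` function. -/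
def openStep {A : Type} (s : Finset ℕ+) : RSym A → Finset ℕ+
  | .open_ i => insert i s
  | .close i => s.erase i
  | _ => s

/-- open : Δ* → finite subsets of ℕ⁺. -/
def openSet {A : Type} (v : List (RSym A)) : Finset ℕ+ :=
  v.foldl openStep ∅

/-- Syntax of regular expressions with backreferences (rewb). -/
inductive Rewb (A : Type) : Type where
  | ch : A → Rewb A
  | eps : Rewb A
  | backref : ℕ+ → Rewb A
  | cat : Rewb A → Rewb A → Rewb A
  | alt : Rewb A → Rewb A → Rewb A
  | star : Rewb A → Rewb A
  | grp : ℕ+ → Rewb A → Rewb A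

/-- `hasIdx i α` : the capturing group `(_i )_i` or the reference `\i` occurs in α. -/
def hasIdx {A : Type} (i : ℕ+) : Rewb A → Prop
  | .ch _ => False
  | .eps => False
  | .backref j => j = i
  | .cat r s => hasIdx i r ∨ hasIdx i s
  | .alt r s => hasIdx i r ∨ hasIdx i s
  | .star r => hasIdx i r
  | .grp j r => j = i ∨ hasIdx i r

/-- Well-formedness of a rewb: in `(_i α)_i`, the body α contains neither the
capturing group `(_i )_i` nor the reference `\i`. -/
def Rewb.WF {A : Type} : Rewb A → Prop
  | .ch _ => True
  | .eps => True
  | .backref _ => True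
  | .cat r s => r.WF ∧ s.WF
  | .alt r s => r.WF ∧ s.WF
  | .star r => r.WF
  | .grp i r => r.WF ∧ ¬ hasIdx i r

/-- The ref-language Ref(α) ⊆ Δ*. -/
def Ref {A : Type} : Rewb A → Language (RSym A)
  | .ch a => {[RSym.ch a]}
  | .eps => 1
  | .backref i => {[RSym.ref i]}
  | .cat r s => Ref r * Ref s
  | .alt r s => Ref r + Ref s
  | .star r => KStar.kstar (Ref r)
  | .grp i r => ({[RSym.open_ i]} : Language (RSym A)) * Ref r * ({[RSym.close i]} : Language (RSym A))

/-- The language of a rewb: L(α) = deref(Ref(α)). -/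
noncomputable def rewbLang {A : Type} (r : Rewb A) : Set (List A) :=
  deref '' (Ref r : Set (List (RSym A)))

/-- capt(α): the set of indices guaranteed to be captured. -/
def capt {A : Type} : Rewb A → Set ℕ+
  | .ch _ => ∅
  | .eps => ∅
  | .backref _ => ∅
  | .cat r s => capt r ∪ capt s
  | .alt r s => capt r ∩ capt s
  | .star r => capt r
  | .grp i r => capt r ∪ {i}

/-- The relation S ⊢ α. -/
def Sat {A : Type} : Rewb A → Set ℕ+ → Prop
  | .ch _, _ => True
  | .eps, _ => True
  | .backref i, S => i ∈ S
  | .cat r s, S => Sat r S ∧ Sat s (S ∪ capt r)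
  | .alt r s, S => Sat r S ∧ Sat s S
  | .star r, S => Sat r S
  | .grp _ r, S => Sat r S

/-- A rewb is closed if ∅ ⊢ α. -/
def Rewb.Closed {A : Type} (r : Rewb A) : Prop := Sat r ∅

/-- A rewb is closed-star if the body of every starred subexpression is closed. -/
def Rewb.ClosedStar {A : Type} : Rewb A → Prop
  | .ch _ => True
  | .eps => True
  | .backref _ => True
  | .cat r s => r.ClosedStar ∧ s.ClosedStar
  | .alt r s => r.ClosedStar ∧ s.ClosedStar
  | .star r => r.ClosedStar ∧ r.Closed
  | .grp _ r => r.ClosedStar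

/-- All indices (number characters and capturing-group indices) occurring in α are ≤ κ. -/
def Rewb.IdxLe {A : Type} (κ : ℕ) : Rewb A → Prop
  | .ch _ => True
  | .eps => True
  | .backref i => (i : ℕ) ≤ κ
  | .cat r s => r.IdxLe κ ∧ s.IdxLe κ
  | .alt r s => r.IdxLe κ ∧ s.IdxLe κ
  | .star r => r.IdxLe κ
  | .grp i r => (i : ℕ) ≤ κ ∧ r.IdxLe κ

/-- All indices occurring in a character of Δ are ≤ κ. -/
def RSym.idxLe {A : Type} (κ : ℕ) : RSym A → Prop
  | .ch _ => True
  | .open_ i => (i : ℕ) ≤ κ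
  | .close i => (i : ℕ) ≤ κ
  | .ref i => (i : ℕ) ≤ κ

/-! ### The tuple functions φ used in the unary-PMCFG construction -/

/-- The ℕ⁺ index corresponding to `j : Fin κ` (memory cell j+1). -/
def toP {κ : ℕ} (j : Fin κ) : ℕ+ := ⟨j.1 + 1, Nat.succ_pos _⟩

/-- φ_c^M : the input/paste/reset/identity functions on (κ+1)-tuples of strings. -/
def phi {A : Type} (κ : ℕ) (M : Finset ℕ+) :
    RSym A → (List A × (Fin κ → List A)) → (List A × (Fin κ → List A))
  | RSym.ch a, (x, y) => (x ++ [a], fun j => if toP j ∈ M then y j ++ [a] else y j)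
  | RSym.ref k, (x, y) =>
      let yk : List A := if h : k.1 ≤ κ ∧ 1 ≤ k.1 then y ⟨k.1 - 1, by omega⟩ else []
      (x ++ yk, fun j => if toP j ∈ M then y j ++ yk else y j)
  | RSym.open_ k, (x, y) => (x, fun j => if toP j = k then [] else y j)
  | RSym.close _, t => t

/-- Apply the functions φ_{v_r}^{open(prefix·v₁⋯v_r)} successively, left to right,
where `pref` is the already-processed prefix. -/
noncomputable def derefRun {A : Type} (κ : ℕ) :
    List (RSym A) → List (RSym A) → (List A × (Fin κ → List A)) → (List A × (Fin κ → List A))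
  | _, [], t => t
  | pref, c :: rest, t => derefRun κ (pref ++ [c]) rest (phi κ (openSet (pref ++ [c])) c t)

/-! ### The quantities t and s -/

/-- One (right-to-left) step of the t-sequence. -/
def tStep {A : Type} (c : RSym A) (t : ℕ+ → ℕ) : ℕ+ → ℕ :=
  match c with
  | .ch _ => t
  | .close _ => t
  | .open_ j => fun k => if k = j then 0 else t k
  | .ref j => fun k => if k = j then t k + 1 else t k

/-- `tOf suf k` is t_{i,k} where `suf` is the suffix v_{i+1} ⋯ v_m of v. -/
def tOf {A : Type} : List (RSym A) → ℕ+ → ℕ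
  | [] => fun _ => 0
  | c :: rest => tStep c (tOf rest)

/-- One (right-to-left) step of the s-sequence; `O` is open(v₁⋯v_i). -/
def sStep {A : Type} (O : Finset ℕ+) (c : RSym A) (s : ℕ+ → ℕ) : ℕ+ → ℕ :=
  match c with
  | .ch _ => s
  | .close _ => s
  | .open_ j => fun k => if k = j then 0 else s k
  | .ref j => fun k => if k = j then max (max 1 (s j)) (O.sup fun l => s l + 1) else s k

/-- `sOf pref suf k` is s_{i,k} where v = pref ++ suf and i = |pref|. -/
def sOf {A : Type} : List (RSym A) → List (RSym A) → ℕ+ → ℕ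
  | _, [] => fun _ => 0
  | pref, c :: rest => sStep (openSet (pref ++ [c])) c (sOf (pref ++ [c]) rest)

/-! ### Parallel multiple context-free grammars -/

/-- An item of an output component of a PMCFG function: a constant string
or the j-th component of the i-th argument. -/
inductive PItem (T : Type) : Type where
  | const : List T → PItem T
  | arg : ℕ → ℕ → PItem T

/-- A rule A → f[A₁,…,A_l] of a PMCFG, where f is given syntactically by the
lists of items of its output components. -/
structure PRule (T N : Type) : Type where
  lhs : N
  rhs : List N
  out : List (List (PItem T))

/-- A PMCFG with nonterminals `Fin n`. -/
structure PMCFG (T : Type) : Type where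
  n : ℕ
  dim : Fin n → ℕ
  start : Fin n
  rules : List (PRule T (Fin n))

/-- Evaluation of a single item, given the tuples derived from the arguments. -/
def evalItem {T : Type} (args : List (List (List T))) : PItem T → List T
  | .const c => c
  | .arg i j => (args.getD i []).getD j []

/-- Evaluation of one output component. -/
def evalItems {T : Type} (args : List (List (List T))) (items : List (PItem T)) : List T :=
  (items.map (evalItem args)).flatten

/-- The set L_G(A) of tuples derived from each nonterminal. -/
inductive PMCFG.Derives {T : Type} (G : PMCFG T) : Fin G.n → List (List T) → Prop
  | step (r : PRule T (Fin G.n)) (hr : r ∈ G.rules) (args : List (List (List T)))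
      (hargs : List.Forall₂ G.Derives r.rhs args) :
      G.Derives r.lhs (r.out.map (evalItems args))

/-- L(G) = L_G(S), identifying 1-tuples with strings. -/
def PMCFG.lang {T : Type} (G : PMCFG T) : Set (List T) :=
  {w | G.Derives G.start [w]}

/-- Well-formedness of a rule with respect to the dimension assignment. -/
def PRule.WFdim {T N : Type} (dim : N → ℕ) (r : PRule T N) : Prop :=
  r.out.length = dim r.lhs ∧
  ∀ items ∈ r.out, ∀ it ∈ items, ∀ i j, it = PItem.arg i j →
    ∃ h : i < r.rhs.length, j < dim (r.rhs.get ⟨i, h⟩)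

/-- G is a well-formed m-PMCFG. -/
def PMCFG.WF {T : Type} (G : PMCFG T) (m : ℕ) : Prop :=
  (∀ A : Fin G.n, 1 ≤ G.dim A ∧ G.dim A ≤ m) ∧ G.dim G.start = 1 ∧
  ∀ r ∈ G.rules, r.WFdim G.dim

/-- G is unary: every function takes at most one argument. -/
def PMCFG.Unary {T : Type} (G : PMCFG T) : Prop :=
  ∀ r ∈ G.rules, r.rhs.length ≤ 1

/-- The list of argument components referenced by a rule. -/
def PRule.argRefs {T N : Type} (r : PRule T N) : List (ℕ × ℕ) :=
  r.out.flatten.filterMap fun it => match it with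
    | .arg i j => some (i, j)
    | _ => none

/-- G is an MCFG: no rule uses the same argument component more than once. -/
def PMCFG.NonDup {T : Type} (G : PMCFG T) : Prop :=
  ∀ r ∈ G.rules, r.argRefs.Nodup

/-! ### Stack automata -/

/-- Direction of the stack pointer. -/
inductive SDir : Type where
  | left | stay | right
deriving DecidableEq

/-- A one-way nondeterministic stack automaton.  The input symbol `none`
denotes the endmarker ▷.  `push q a Z` is the pushdown mode (applicable when the
stack pointer is at the top symbol Z; the Bool is whether the input head moves
right); `read q a Z top` is the stack-reading mode (`top` tells whether the
pointed symbol Z is the topmost one). -/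
structure SA (T : Type) : Type 1 where
  Q : Type
  finQ : Fintype Q
  Γ : Type
  finΓ : Fintype Γ
  q0 : Q
  Z0 : Γ
  F : Set Q
  push : Q → Option T → Γ → Set (Q × Bool × List Γ)
  read : Q → Option T → Γ → Bool → Set (Q × Bool × SDir)

namespace SA

/-- Instantaneous description: state, remaining input (the endmarker ▷ is
implicit at the end), stack below-and-including the pointer, stack above the
pointer. -/
def Conf {T : Type} (M : SA T) : Type := M.Q × List T × List M.Γ × List M.Γ

/-- Move the stack pointer: the stack is γ ++ [Z] ++ above with the pointer on Z. -/
def moveStack {Γ : Type} : SDir → List Γ → Γ → List Γ → List Γ × List Γ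
  | .left, γ, Z, above => (γ, Z :: above)
  | .stay, γ, Z, above => (γ ++ [Z], above)
  | .right, γ, Z, b :: rest => (γ ++ [Z, b], rest)
  | .right, γ, Z, [] => (γ ++ [Z], [])

/-- One move of a stack automaton on instantaneous descriptions. -/
inductive Step {T : Type} (M : SA T) : M.Conf → M.Conf → Prop
  | push (q : M.Q) (u : List T) (γ : List M.Γ) (Z : M.Γ) (q' : M.Q) (d : Bool) (y : List M.Γ)
      (hmem : (q', d, y) ∈ M.push q u.head? Z)
      (hd : d = true → u ≠ []) :
      Step M (q, u, γ ++ [Z], []) (q', if d then u.tail else u, γ ++ y, [])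
  | read (q : M.Q) (u : List T) (γ : List M.Γ) (Z : M.Γ) (above : List M.Γ)
      (q' : M.Q) (d : Bool) (e : SDir)
      (hmem : (q', d, e) ∈ M.read q u.head? Z above.isEmpty)
      (hd : d = true → u ≠ [])
      (hleft : e = SDir.left → γ ≠ [])
      (hright : e = SDir.right → above ≠ []) :
      Step M (q, u, γ ++ [Z], above)
        (q', if d then u.tail else u, (moveStack e γ Z above).1, (moveStack e γ Z above).2)

/-- Acceptance: from (q₀, w▷, Z₀↑$) reach a final state with the whole input read. -/
def Accepts {T : Type} (M : SA T) (w : List T) : Prop :=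
  ∃ (qf : M.Q) (g1 g2 : List M.Γ), qf ∈ M.F ∧
    Relation.ReflTransGen (Step M) (M.q0, w, [M.Z0], []) (qf, [], g1, g2)

/-- The language of a stack automaton. -/
def lang {T : Type} (M : SA T) : Set (List T) := {w | M.Accepts w}

/-- Nonerasing: every pushdown-mode transition pushes a nonempty word. -/
def NonErasing {T : Type} (M : SA T) : Prop :=
  ∀ q a Z q' d y, (q', d, y) ∈ M.push q a Z → y ≠ []

end SA

/-- One step of the automaton checking that the brackets with index `i` alternate, starting with an
opening one: the state `some b` records whether group `i` is open, and `none` is the error state. -/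
def bracketStep {A : Type} (i : ℕ+) (s : Option Bool) : RSym A → Option Bool
  | .open_ j => if j = i then (if s = some false then some true else none) else s
  | .close j => if j = i then (if s = some true then some false else none) else s
  | _ => s

lemma foldl_bracketStep_none {A : Type} (i : ℕ+) (w : List (RSym A)) :
    w.foldl (bracketStep i) none = none := by
  induction w with
  | nil => rfl
  | cons c w ih =>
    have h : bracketStep i none c = none := by cases c <;> simp [bracketStep]
    rw [List.foldl_cons, h, ih]

lemma bracketStep_inj {A : Type} {i : ℕ+} {c : RSym A} {s s' : Option Bool}
    (h : bracketStep i s c = bracketStep i s' c) (hs : bracketStep i s c ≠ none) : s = s' := by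
  cases c <;> simp only [bracketStep] at h hs <;> grind

lemma foldl_bracketStep_inj {A : Type} {i : ℕ+} {b : Bool} {w : List (RSym A)}
    {s s' : Option Bool} (h : w.foldl (bracketStep i) s = some b)
    (h' : w.foldl (bracketStep i) s' = some b) : s = s' := by
  induction w generalizing s s' with
  | nil => exact h.trans h'.symm
  | cons c w ih =>
    rw [List.foldl_cons] at h h'
    refine bracketStep_inj (ih h h') fun hn => ?_
    rw [hn, foldl_bracketStep_none] at h
    cases h

lemma bracketStep_decide_mem {A : Type} {i : ℕ+} {c : RSym A} {S : Finset ℕ+}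
    (h : bracketStep i (some (decide (i ∈ S))) c ≠ none) :
    bracketStep i (some (decide (i ∈ S))) c = some (decide (i ∈ openStep S c)) := by
  cases c with
  | ch a => rfl
  | ref j => rfl
  | open_ j => by_cases hj : j = i <;> by_cases hi : i ∈ S <;>
      simp_all [bracketStep, openStep, eq_comm]
  | close j => by_cases hj : j = i <;> by_cases hi : i ∈ S <;>
      simp_all [bracketStep, openStep, eq_comm]

lemma mem_foldl_openStep_iff {A : Type} {i : ℕ+} {v : List (RSym A)} {S : Finset ℕ+} {b : Bool}
    (h : v.foldl (bracketStep i) (some (decide (i ∈ S))) = some b) :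
    i ∈ v.foldl openStep S ↔ b = true := by
  induction v generalizing S with
  | nil => simpa using congrArg (· = some true) h
  | cons c v ih =>
    rw [List.foldl_cons] at h ⊢
    have hc := bracketStep_decide_mem (i := i) (c := c) (S := S) fun hn => by
      rw [hn, foldl_bracketStep_none] at h
      cases h
    exact ih (hc ▸ h)

lemma foldl_bracketStep_kstar {A : Type} {i : ℕ+} {L : Language (RSym A)} {s : Option Bool}
    (hL : ∀ w ∈ L, w.foldl (bracketStep i) s = s) {w : List (RSym A)}
    (hw : w ∈ KStar.kstar L) : w.foldl (bracketStep i) s = s := by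
  obtain ⟨l, rfl, hl⟩ := Language.mem_kstar.mp hw
  clear hw
  induction l with
  | nil => rfl
  | cons u l ih =>
    have hl' : ∀ y ∈ l, y ∈ L := fun y hy => hl y (List.mem_cons_of_mem _ hy)
    rw [List.flatten_cons, List.foldl_append, hL u (hl u List.mem_cons_self)]
    exact ih hl'

lemma foldl_bracketStep_ref_of_not_hasIdx {A : Type} {i : ℕ+} {α : Rewb A} (h : ¬ hasIdx i α)
    (s : Option Bool) {w : List (RSym A)} (hw : w ∈ Ref α) : w.foldl (bracketStep i) s = s := by
  induction α generalizing w with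
  | ch a => rw [show w = [RSym.ch a] from hw]; rfl
  | eps => rw [show w = [] from hw]; rfl
  | backref j => rw [show w = [RSym.ref j] from hw]; rfl
  | cat r t ihr iht =>
    obtain ⟨u, hu, v, hv, rfl⟩ := Language.mem_mul.mp hw
    rw [List.foldl_append, ihr (fun hr => h (Or.inl hr)) hu, iht (fun ht => h (Or.inr ht)) hv]
  | alt r t ihr iht =>
    rcases hw with hw | hw
    · exact ihr (fun hr => h (Or.inl hr)) hw
    · exact iht (fun ht => h (Or.inr ht)) hw
  | star r ih => exact foldl_bracketStep_kstar (fun _ hu => ih h hu) hw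
  | grp j r ih =>
    obtain ⟨u, ⟨_, rfl, v, hv, rfl⟩, _, rfl, rfl⟩ := hw
    have hj : j ≠ i := fun hj => h (Or.inl hj)
    have hr : ¬ hasIdx i r := fun hr => h (Or.inr hr)
    simp [bracketStep, hj, ih hr hv]

lemma foldl_bracketStep_ref {A : Type} (i : ℕ+) {α : Rewb A} (hwf : α.WF)
    {w : List (RSym A)} (hw : w ∈ Ref α) :
    w.foldl (bracketStep i) (some false) = some false := by
  induction α generalizing w with
  | ch a => rw [show w = [RSym.ch a] from hw]; rfl
  | eps => rw [show w = [] from hw]; rfl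
  | backref j => rw [show w = [RSym.ref j] from hw]; rfl
  | cat r t ihr iht =>
    obtain ⟨u, hu, v, hv, rfl⟩ := Language.mem_mul.mp hw
    rw [List.foldl_append, ihr hwf.1 hu, iht hwf.2 hv]
  | alt r t ihr iht =>
    rcases hw with hw | hw
    · exact ihr hwf.1 hw
    · exact iht hwf.2 hw
  | star r ih => exact foldl_bracketStep_kstar (fun _ hu => ih hwf hu) hw
  | grp j r ih =>
    obtain ⟨u, ⟨_, rfl, v, hv, rfl⟩, _, rfl, rfl⟩ := hw
    by_cases hj : j = i
    · subst hj
      simp [bracketStep, foldl_bracketStep_ref_of_not_hasIdx hwf.2 _ hv]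
    · simp [bracketStep, hj, ih hwf.1 hv]

lemma foldl_bracketStep_ref_prefix {A : Type} (i : ℕ+) {α : Rewb A} (hwf : α.WF)
    {v w : List (RSym A)} (hvw : v ++ w ∈ Ref α) :
    v.foldl (bracketStep i) (some false) = some (decide (i ∈ openSet v)) := by
  have h := foldl_bracketStep_ref i hwf hvw
  rw [List.foldl_append] at h
  cases hv : v.foldl (bracketStep i) (some false) with
  | none => rw [hv, foldl_bracketStep_none] at h; cases h
  | some b =>
    have := mem_foldl_openStep_iff (S := ∅) (by simpa using hv)
    simp [openSet, this]

/-- The open groups of a prefix of a word of `Ref α` are determined by the remaining suffix. -/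
lemma openSet_eq_of_append_mem_ref {A : Type} {α : Rewb A} (hwf : α.WF)
    {v₁ v₂ w : List (RSym A)} (h₁ : v₁ ++ w ∈ Ref α) (h₂ : v₂ ++ w ∈ Ref α) :
    openSet v₁ = openSet v₂ := by
  ext i
  have e₁ := foldl_bracketStep_ref i hwf h₁
  have e₂ := foldl_bracketStep_ref i hwf h₂
  rw [List.foldl_append] at e₁ e₂
  have h := foldl_bracketStep_inj e₁ e₂
  rw [foldl_bracketStep_ref_prefix i hwf h₁, foldl_bracketStep_ref_prefix i hwf h₂] at h
  simpa using h

/-- Lemma om. -/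
theorem stmt6 {A : Type} {Q : Type} [Fintype Q] (κ : ℕ)
    (α : Rewb A) (hwf : α.WF) (hκ : α.IdxLe κ)
    (M : NFA (RSym A) Q) (q0 : Q) (hstart : M.start = {q0})
    (hlang : M.accepts = Ref α)
    (halpha : ∀ q (c : RSym A) q', q' ∈ M.step q c → c.idxLe κ)
    (hreach : ∀ q : Q, (∃ v, q ∈ M.evalFrom {q0} v) ∧
      (∃ w, ∃ q' ∈ M.accept, q' ∈ M.evalFrom {q} w))
    (hbr : ∀ q q' (i : ℕ+),
      (q' ∈ M.step q (RSym.open_ i) → ∀ c, q' ∈ M.step q c → c = RSym.open_ i) ∧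
      (q' ∈ M.step q (RSym.close i) → ∀ c, q' ∈ M.step q c → c = RSym.close i))
    (q : Q) (v₁ v₂ : List (RSym A))
    (hv₁ : ∀ c ∈ v₁, RSym.idxLe κ c) (hv₂ : ∀ c ∈ v₂, RSym.idxLe κ c)
    (h1 : q ∈ M.evalFrom {q0} v₁) (h2 : q ∈ M.evalFrom {q0} v₂) :
    openSet v₁ = openSet v₂ := by
  obtain ⟨w, q', hq', hw⟩ := (hreach q).2
  have key : ∀ v, q ∈ M.evalFrom {q0} v → v ++ w ∈ Ref α := fun v hv => by
    rw [← hlang, NFA.mem_accepts, hstart, NFA.evalFrom_append]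
    exact ⟨q', hq', M.mem_evalFrom_iff_exists.mpr ⟨q, hv, hw⟩⟩
  exact openSet_eq_of_append_mem_ref hwf (key v₁ h1) (key v₂ h2)

end Rewbs
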